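/- Let v ∈ ℂ[x,y] be a variable, i.e. there exists a ℂ-algebra automorphism φ of ℂ[x,y] with φ(x) = v, and let q ∈ ℂ ∖ ℝ. Then there exists an ℝ-algebra automorphism f of ℝ[x,y,z] with f(z) = z whose first component specializes to v at z = q: the image of f(x) under the ring homomorphism ℝ[x,y,z] → ℂ[x,y] given by x ↦ x, y ↦ y, z ↦ q equals v. -/

import Mathlib

open MvPolynomial

/-- Evaluation `ℝ[x,y,z] → ℂ[x,y]` sending `x ↦ x`, `y ↦ y`, `z ↦ q`. -/
noncomputable def evq16 (q : ℂ) : MvPolynomial (Fin 3) ℝ →ₐ[ℝ] MvPolynomial (Fin 2) ℂ :=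
  aeval ![X 0, X 1, MvPolynomial.C q]

abbrev PR := MvPolynomial (Fin 2) ℂ

def wt16 (a b : ℤ) (s : Fin 2 →₀ ℕ) : ℤ := a * s 0 + b * s 1

lemma wt16_add (a b : ℤ) (s t : Fin 2 →₀ ℕ) : wt16 a b (s + t) = wt16 a b s + wt16 a b t := by
  simp [wt16]; ring

def Fil (a b e : ℤ) : Submodule ℂ PR where
  carrier := {h | ∀ s, coeff s h ≠ 0 → wt16 a b s ≤ e}
  zero_mem' := by intro s hs; simp at hs
  add_mem' := by
    intro f g hf hg s hs
    rw [coeff_add] at hs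
    by_cases h : coeff s f = 0
    · rw [h, zero_add] at hs; exact hg s hs
    · exact hf s h
  smul_mem' := by
    intro c f hf s hs
    rw [coeff_smul, smul_eq_mul] at hs
    exact hf s (right_ne_zero_of_mul hs)

lemma mem_Fil {a b e : ℤ} {h : PR} : h ∈ Fil a b e ↔ ∀ s, coeff s h ≠ 0 → wt16 a b s ≤ e := Iff.rfl

lemma Fil_mono {a b e e' : ℤ} (h : e ≤ e') {f : PR} (hf : f ∈ Fil a b e) : f ∈ Fil a b e' :=
  fun s hs => (hf s hs).trans h

lemma Fil_mul {a b e e' : ℤ} {f g : PR} (hf : f ∈ Fil a b e) (hg : g ∈ Fil a b e') :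
    f * g ∈ Fil a b (e + e') := by
  classical
  intro s hs
  rw [coeff_mul] at hs
  obtain ⟨p, hp, hne⟩ := Finset.exists_ne_zero_of_sum_ne_zero hs
  rw [Finset.HasAntidiagonal.mem_antidiagonal] at hp
  have h1 := hf p.1 (left_ne_zero_of_mul hne)
  have h2 := hg p.2 (right_ne_zero_of_mul hne)
  rw [← hp, wt16_add]; linarith

lemma Fil_pderiv0 {a b e : ℤ} {f : PR} (hf : f ∈ Fil a b e) : pderiv 0 f ∈ Fil a b (e - a) := by
  intro s hs
  rw [coeff_pderiv] at hs
  have := hf _ (left_ne_zero_of_mul hs)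
  rw [wt16_add] at this
  simp [wt16] at this ⊢; linarith

lemma Fil_pderiv1 {a b e : ℤ} {f : PR} (hf : f ∈ Fil a b e) : pderiv 1 f ∈ Fil a b (e - b) := by
  intro s hs
  rw [coeff_pderiv] at hs
  have := hf _ (left_ne_zero_of_mul hs)
  rw [wt16_add] at this
  simp [wt16] at this ⊢; linarith

lemma der_formula (D : Derivation ℂ PR PR) (f : PR) :
    D f = pderiv 0 f * D (X 0) + pderiv 1 f * D (X 1) := by
  have : D = (D (X 0)) • (pderiv 0 : Derivation ℂ PR PR) + (D (X 1)) • (pderiv 1 : Derivation ℂ PR PR) := by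
    apply derivation_ext
    intro i
    fin_cases i <;> simp [pderiv_X]
  conv_lhs => rw [this]
  simp [mul_comm]

lemma Fil_der {a b d : ℤ} {D : Derivation ℂ PR PR} (h0 : D (X 0) ∈ Fil a b (a + d))
    (h1 : D (X 1) ∈ Fil a b (b + d)) {e : ℤ} {f : PR} (hf : f ∈ Fil a b e) :
    D f ∈ Fil a b (e + d) := by
  rw [der_formula]
  refine Submodule.add_mem _ ?_ ?_
  · have := Fil_mul (Fil_pderiv0 hf) h0
    exact Fil_mono (by linarith) this
  · have := Fil_mul (Fil_pderiv1 hf) h1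
    exact Fil_mono (by linarith) this

lemma Fil_exists (a b : ℤ) (f : PR) : ∃ e, f ∈ Fil a b e := by
  refine ⟨∑ s ∈ f.support, |wt16 a b s|, fun s hs => ?_⟩
  refine (le_abs_self _).trans ?_
  exact Finset.single_le_sum (f := fun s => |wt16 a b s|) (fun _ _ => abs_nonneg _) (mem_support_iff.2 hs)

/-- homogeneous part -/
noncomputable def lead (a b e : ℤ) (f : PR) : PR := 
  ∑ s ∈ f.support.filter (fun s => wt16 a b s = e), monomial s (coeff s f)

lemma coeff_lead (a b e : ℤ) (f : PR) (s : Fin 2 →₀ ℕ) :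
    coeff s (lead a b e f) = if wt16 a b s = e then coeff s f else 0 := by
  classical
  simp only [lead, coeff_sum, coeff_monomial]
  rw [Finset.sum_ite_eq']
  simp only [Finset.mem_filter, mem_support_iff]
  by_cases h : coeff s f = 0 <;> simp [h]

lemma lead_mem (a b e : ℤ) (f : PR) : lead a b e f ∈ Fil a b e := by
  intro s hs
  rw [coeff_lead] at hs
  by_contra h
  rw [if_neg (by omega)] at hs
  exact hs rfl

lemma lead_mem' (a b e : ℤ) (f : PR) : lead a b e f ∈ Fil (-a) (-b) (-e) := by
  intro s hs
  rw [coeff_lead] at hs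
  by_contra h
  rw [if_neg] at hs
  · exact hs rfl
  · intro h'; apply h; simp [wt16] at h' ⊢; linarith

lemma sub_lead_mem {a b e : ℤ} {f : PR} (hf : f ∈ Fil a b e) : f - lead a b e f ∈ Fil a b (e - 1) := by
  intro s hs
  rw [coeff_sub, coeff_lead] at hs
  split_ifs at hs with h
  · simp at hs
  · rw [sub_zero] at hs
    have := hf s hs
    omega

lemma Fil_zero {a b e : ℤ} {f : PR} (h : f ∈ Fil a b (e - 1)) (h' : f ∈ Fil (-a) (-b) (-e)) : f = 0 := by
  ext s
  by_contra hs
  have h1 := h s hs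
  have h2 := h' s hs
  simp [wt16] at h1 h2
  linarith

def IsLND (E : Derivation ℂ PR PR) : Prop := ∀ f, ∃ N : ℕ, E^[N] f = 0

lemma iter_zero {E : Derivation ℂ PR PR} {N M : ℕ} {f : PR} (h : E^[N] f = 0) (hNM : N ≤ M) :
    E^[M] f = 0 := by
  obtain ⟨k, rfl⟩ := Nat.exists_eq_add_of_le' hNM
  rw [Function.iterate_add_apply, h, iterate_map_zero]

lemma lnd_leib (E : Derivation ℂ PR PR) (k : ℕ) : ∀ (N M : ℕ) (f g : PR), N + M = k → 
    E^[N+1] f = 0 → E^[M+1] g = 0 →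
    E^[k] (f * g) = (k.choose N : PR) * (E^[N] f * E^[M] g) := by
  induction k with
  | zero =>
    intro N M f g h _ _
    obtain ⟨rfl, rfl⟩ : N = 0 ∧ M = 0 := by omega
    simp
  | succ k ih =>
    intro N M f g h hf hg
    rw [Function.iterate_succ_apply, Derivation.leibniz, smul_eq_mul, smul_eq_mul, iterate_map_add]
    rcases N with _ | N
    · have hf0 : E f = 0 := hf
      obtain ⟨M, rfl⟩ : ∃ M', M = M' + 1 := ⟨M - 1, by omega⟩
      rw [hf0, mul_zero, iterate_map_zero, add_zero, ih 0 M f (E g) (by omega) hf hg]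
      simp
    · rcases M with _ | M
      · have hg0 : E g = 0 := hg
        rw [hg0, mul_zero, iterate_map_zero, zero_add, mul_comm, ih N 0 (E f) g (by omega) hf hg]
        obtain rfl : N = k := by omega
        simp
      · rw [ih (N+1) M f (E g) (by omega) hf hg, mul_comm g, ih N (M+1) (E f) g (by omega) hf hg]
        rw [Nat.choose_succ_succ]
        push_cast
        simp only [Function.iterate_succ_apply]
        ring

lemma lnd_deg {E : Derivation ℂ PR PR} (hE : IsLND E) {f : PR} (hf : f ≠ 0) :
    ∃ N, E^[N] f ≠ 0 ∧ E^[N+1] f = 0 := by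
  classical
  have h := hE f
  have h1 := Nat.find_spec h
  have h2 : Nat.find h ≠ 0 := by
    intro h0; rw [h0] at h1; exact hf h1
  obtain ⟨N, hN⟩ := Nat.exists_eq_succ_of_ne_zero h2
  refine ⟨N, Nat.find_min h (by omega), ?_⟩
  rw [hN] at h1; exact h1

lemma lnd_mul_ne {E : Derivation ℂ PR PR} {f g : PR} {N M : ℕ} (h1 : E^[N] f ≠ 0)
    (h2 : E^[N+1] f = 0) (h3 : E^[M] g ≠ 0) (h4 : E^[M+1] g = 0) : E^[N+M] (f * g) ≠ 0 := by
  rw [lnd_leib E _ N M f g rfl h2 h4]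
  refine mul_ne_zero ?_ (mul_ne_zero h1 h3)
  exact_mod_cast (Nat.choose_pos (by omega)).ne'

lemma lnd_fact {E : Derivation ℂ PR PR} (hE : IsLND E) {f g : PR} (h : f * g ≠ 0)
    (h0 : E (f * g) = 0) : E f = 0 := by
  obtain ⟨N, h1, h2⟩ := lnd_deg hE (left_ne_zero_of_mul h)
  obtain ⟨M, h3, h4⟩ := lnd_deg hE (right_ne_zero_of_mul h)
  have := lnd_mul_ne h1 h2 h3 h4
  have hN : N = 0 := by
    by_contra hN
    exact this (iter_zero (N := 1) h0 (by omega))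
  subst hN
  exact h2

lemma lnd_lt {E : Derivation ℂ PR PR} (hE : IsLND E) {f y : PR} (hf : f ≠ 0) (hy : y ∣ f)
    {N M : ℕ} (hN : E^[N] f = 0) (h3 : E^[M] y ≠ 0) (h4 : E^[M+1] y = 0) : M < N := by
  obtain ⟨u, rfl⟩ := hy
  obtain ⟨K, h1, h2⟩ := lnd_deg hE (right_ne_zero_of_mul hf)
  by_contra hlt
  exact lnd_mul_ne h3 h4 h1 h2 (iter_zero hN (by omega))

lemma lnd_cross {E : Derivation ℂ PR PR} (hE : IsLND E) {x y : PR} (hx : E x ≠ 0) (hy : E y ≠ 0)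
    (h1 : y ∣ E x) (h2 : x ∣ E y) : False := by
  have hx0 : x ≠ 0 := by rintro rfl; simp at hx
  have hy0 : y ≠ 0 := by rintro rfl; simp at hy
  obtain ⟨N, a1, a2⟩ := lnd_deg hE hx0
  obtain ⟨M, b1, b2⟩ := lnd_deg hE hy0
  have := lnd_lt hE hx h1 (N := N) a2 b1 b2
  have := lnd_lt hE hy h2 (N := M) b2 a1 a2
  omega

/-- leading derivation -/
lemma exists_lead_der (a b : ℤ) (D : Derivation ℂ PR PR) (hD : D ≠ 0) :
    ∃ (d : ℤ) (E : Derivation ℂ PR PR), E ≠ 0 ∧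
      (∀ e f, f ∈ Fil a b e → E f ∈ Fil a b (e + d)) ∧
      (∀ e f, f ∈ Fil (-a) (-b) (-e) → E f ∈ Fil (-a) (-b) (-(e + d))) ∧
      (∀ e f, f ∈ Fil a b e → (D - E) f ∈ Fil a b (e + d - 1)) := by
  obtain ⟨d, ⟨hd0, hd1⟩, hmin⟩ : ∃ d : ℤ, (D (X 0) ∈ Fil a b (a + d) ∧ D (X 1) ∈ Fil a b (b + d)) ∧
      ∀ z : ℤ, (D (X 0) ∈ Fil a b (a + z) ∧ D (X 1) ∈ Fil a b (b + z)) → d ≤ z := by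
    apply Int.exists_least_of_bdd
    · have : D (X 0) ≠ 0 ∨ D (X 1) ≠ 0 := by
        by_contra! h
        apply hD
        apply derivation_ext
        intro i
        fin_cases i
        · simpa using h.1
        · simpa using h.2
      rcases this with h | h
      · obtain ⟨s, hs⟩ := ne_zero_iff.1 h
        exact ⟨wt16 a b s - a, fun z hz => by have := hz.1 s hs; linarith⟩
      · obtain ⟨s, hs⟩ := ne_zero_iff.1 h
        exact ⟨wt16 a b s - b, fun z hz => by have := hz.2 s hs; linarith⟩
    · obtain ⟨e0, h0⟩ := Fil_exists a b (D (X 0))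
      obtain ⟨e1, h1⟩ := Fil_exists a b (D (X 1))
      exact ⟨max (e0 - a) (e1 - b), Fil_mono (by have := le_max_left (e0 - a) (e1 - b); linarith) h0,
        Fil_mono (by have := le_max_right (e0 - a) (e1 - b); linarith) h1⟩
  let E : Derivation ℂ PR PR := mkDerivation ℂ ![lead a b (a + d) (D (X 0)), lead a b (b + d) (D (X 1))]
  have E0 : E (X 0) = lead a b (a + d) (D (X 0)) := by simp [E]
  have E1 : E (X 1) = lead a b (b + d) (D (X 1)) := by simp [E]
  have hDE : ∀ e f, f ∈ Fil a b e → (D - E) f ∈ Fil a b (e + d - 1) := by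
    intro e f hf
    have := Fil_der (a := a) (b := b) (d := d - 1) (D := D - E) ?_ ?_ hf
    · exact Fil_mono (by linarith) this
    · have := sub_lead_mem hd0
      rw [Derivation.sub_apply, E0]
      exact Fil_mono (by linarith) this
    · have := sub_lead_mem hd1
      rw [Derivation.sub_apply, E1]
      exact Fil_mono (by linarith) this
  refine ⟨d, E, ?_, ?_, ?_, hDE⟩
  · intro hE
    have h0 := sub_lead_mem hd0
    have h1 := sub_lead_mem hd1
    rw [← E0, hE, Derivation.zero_apply, sub_zero] at h0
    rw [← E1, hE, Derivation.zero_apply, sub_zero] at h1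
    have := hmin (d - 1) ⟨Fil_mono (by linarith) h0, Fil_mono (by linarith) h1⟩
    linarith
  · intro e f hf
    exact Fil_der (by rw [E0]; exact lead_mem _ _ _ _) (by rw [E1]; exact lead_mem _ _ _ _) hf
  · intro e f hf
    have := Fil_der (a := -a) (b := -b) (d := -d) (D := E)
      (by rw [E0]; exact Fil_mono (by linarith) (lead_mem' _ _ _ _))
      (by rw [E1]; exact Fil_mono (by linarith) (lead_mem' _ _ _ _)) hf
    exact Fil_mono (by linarith) this

lemma lead_der_lnd {a b d : ℤ} {D E : Derivation ℂ PR PR} (hD : IsLND D)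
    (h1 : ∀ e f, f ∈ Fil a b e → E f ∈ Fil a b (e + d))
    (h2 : ∀ e f, f ∈ Fil (-a) (-b) (-e) → E f ∈ Fil (-a) (-b) (-(e + d)))
    (h3 : ∀ e f, f ∈ Fil a b e → (D - E) f ∈ Fil a b (e + d - 1)) : IsLND E := by
  have hDf : ∀ e f, f ∈ Fil a b e → D f ∈ Fil a b (e + d) := by
    intro e f hf
    have : D f = E f + (D - E) f := by simp
    rw [this]
    exact Submodule.add_mem _ (h1 e f hf) (Fil_mono (by linarith) (h3 e f hf))
  have hom : ∀ e f, f ∈ Fil a b e → f ∈ Fil (-a) (-b) (-e) → ∃ N : ℕ, E^[N] f = 0 := by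
    intro e f hf hf'
    obtain ⟨N, hN⟩ := hD f
    have key : ∀ k : ℕ, E^[k] f ∈ Fil a b (e + k * d) ∧ E^[k] f ∈ Fil (-a) (-b) (-(e + k * d)) ∧
        D^[k] f - E^[k] f ∈ Fil a b (e + k * d - 1) := by
      intro k
      induction k with
      | zero => simpa using ⟨hf, by simpa [add_comm] using hf'⟩
      | succ k ih =>
        obtain ⟨i1, i2, i3⟩ := ih
        simp only [Function.iterate_succ_apply']
        refine ⟨Fil_mono (by push_cast; linarith) (h1 _ _ i1), 
          Fil_mono (by push_cast; linarith) (h2 _ _ i2), ?_⟩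
        have : D (D^[k] f) - E (E^[k] f) = D (D^[k] f - E^[k] f) + (D - E) (E^[k] f) := by
          simp
        rw [this]
        exact Submodule.add_mem _ (Fil_mono (by push_cast; linarith) (hDf _ _ i3))
          (Fil_mono (by push_cast; linarith) (h3 _ _ i1))
    obtain ⟨i1, i2, i3⟩ := key N
    rw [hN, zero_sub] at i3
    exact ⟨N, Fil_zero ((Submodule.neg_mem_iff _).1 i3) i2⟩
  intro f
  induction f using MvPolynomial.monomial_add_induction_on with
  | C c => exact ⟨1, by simp⟩
  | monomial_add s c f _ _ ih =>
    obtain ⟨N, hN⟩ := ih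
    obtain ⟨M, hM⟩ := hom (wt16 a b s) (monomial s c) (by
        classical
        intro t ht
        rw [coeff_monomial] at ht
        split_ifs at ht with h
        · rw [h]
        · exact absurd rfl ht) (by
        classical
        intro t ht
        rw [coeff_monomial] at ht
        split_ifs at ht with h
        · rw [h]; simp [wt16]
        · exact absurd rfl ht)
    refine ⟨max N M, ?_⟩
    rw [iterate_map_add, iter_zero hN (le_max_left _ _), iter_zero hM (le_max_right _ _), add_zero]

lemma dvd_of_coeff {i : Fin 2} {f : PR} (h : ∀ s : Fin 2 →₀ ℕ, s i = 0 → coeff s f = 0) : (X i : PR) ∣ f := by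
  rw [f.as_sum]
  refine Finset.dvd_sum fun s hs => ?_
  rw [X_dvd_monomial]
  right
  intro h0
  exact mem_support_iff.1 hs (h s h0)

lemma coeff_of_dvd {i : Fin 2} {f : PR} (h : (X i : PR) ∣ f) {s : Fin 2 →₀ ℕ} (hs : s i = 0) : coeff s f = 0 := by
  classical
  obtain ⟨g, rfl⟩ := h
  rw [coeff_X_mul', if_neg]
  simp [hs]

lemma exists_deg {i : Fin 2} {v : PR} (hv : v ≠ 0) : ∃ s, coeff s v ≠ 0 ∧ s i = degreeOf i v := by
  rw [degreeOf_eq_sup]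
  obtain ⟨s, hs, h⟩ := Finset.exists_mem_eq_sup v.support (support_nonempty.2 hv) (fun m => m i)
  exact ⟨s, mem_support_iff.1 hs, h.symm⟩

lemma pderiv_zero {i : Fin 2} {f : PR} (h : pderiv i f = 0) {s : Fin 2 →₀ ℕ} (hs : coeff s f ≠ 0) : s i = 0 := by
  by_contra h0
  have h1 := coeff_pderiv (i := i) f (s - Finsupp.single i 1)
  have h2 : s - Finsupp.single i 1 + Finsupp.single i 1 = s := by
    apply tsub_add_cancel_of_le
    rw [Finsupp.single_le_iff]; omega
  rw [h, h2, coeff_zero] at h1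
  have h3 := (mul_eq_zero.1 h1.symm).resolve_left hs
  norm_cast at h3

lemma der_ne_zero {E : Derivation ℂ PR PR} (hE : E ≠ 0) (h0 : E (X 0) = 0) (h1 : E (X 1) = 0) : False := by
  apply hE
  apply derivation_ext
  intro i
  fin_cases i
  · simpa using h0
  · simpa using h1

lemma fin2_ext {s t : Fin 2 →₀ ℕ} (h0 : s 0 = t 0) (h1 : s 1 = t 1) : s = t := by
  ext i; fin_cases i
  · exact h0
  · exact h1

set_option maxHeartbeats 2000000 in
lemma key16 {D : Derivation ℂ PR PR} (hD : IsLND D) (hD0 : D ≠ 0) {v : PR} (hv : D v = 0)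
    {n m : ℕ} (hdn : degreeOf 0 v = n) (hdm : degreeOf 1 v = m) (hn : 0 < n) (hm : 0 < m) :
    v ∈ Fil m n (m * n) ∧ coeff (Finsupp.single 0 n) v ≠ 0 ∧ (n ∣ m ∨ m ∣ n) := by
  have hv0 : v ≠ 0 := by rintro rfl; simp at hdn; omega
  obtain ⟨d, E, hE0, h1, h2, h3⟩ := exists_lead_der m n D hD0
  have hE := lead_der_lnd hD h1 h2 h3
  obtain ⟨s0, hs0, hs0n⟩ := exists_deg (i := 0) hv0
  obtain ⟨t0, ht0, ht0m⟩ := exists_deg (i := 1) hv0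
  rw [hdn] at hs0n
  rw [hdm] at ht0m
  obtain ⟨W, hW, hmin⟩ : ∃ W : ℤ, v ∈ Fil m n W ∧ ∀ z, v ∈ Fil m n z → W ≤ z := by
    apply Int.exists_least_of_bdd
    · exact ⟨wt16 m n s0, fun z hz => hz s0 hs0⟩
    · exact Fil_exists _ _ _
  set u := lead m n W v with hu
  have hu0 : u ≠ 0 := by
    intro h
    have := sub_lead_mem hW
    rw [← hu, h, sub_zero] at this
    have := hmin _ this
    omega
  have hn' : (0 : ℤ) < n := by exact_mod_cast hn
  have hm' : (0 : ℤ) < m := by exact_mod_cast hm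
  have hsupp : ∀ s, coeff s u ≠ 0 → (m : ℤ) * s 0 + n * s 1 = W ∧ coeff s v ≠ 0 ∧ (s 0 : ℤ) ≤ n ∧ (s 1 : ℤ) ≤ m := by
    intro s hs
    rw [hu, coeff_lead] at hs
    split_ifs at hs with h
    · refine ⟨h, hs, ?_, ?_⟩
      · have := monomial_le_degreeOf 0 (mem_support_iff.2 hs); rw [hdn] at this; exact_mod_cast this
      · have := monomial_le_degreeOf 1 (mem_support_iff.2 hs); rw [hdm] at this; exact_mod_cast this
    · exact absurd rfl hs
  have hsupp' : ∀ s, coeff s v ≠ 0 → (m : ℤ) * s 0 + n * s 1 = W → coeff s u ≠ 0 := by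
    intro s hs h
    rw [hu, coeff_lead, if_pos (show wt16 m n s = W from h)]; exact hs
  have hEu : E u = 0 := by
    apply Fil_zero (a := m) (b := n) (e := W + d)
    · have : E u = -(E (v - u)  + (D - E) v) := by simp [hv]
      rw [this]
      apply Submodule.neg_mem
      exact Submodule.add_mem _ (Fil_mono (by linarith) (h1 _ _ (sub_lead_mem hW))) (h3 _ _ hW)
    · exact h2 _ _ (lead_mem' _ _ _ _)
  have hWs := hW s0 hs0
  have hWt := hW t0 ht0
  simp only [wt16, hs0n, ht0m] at hWs hWt
  have hs0p : (0 : ℤ) ≤ s0 1 := by positivity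
  have ht0p : (0 : ℤ) ≤ t0 0 := by positivity
  have hWge : (m : ℤ) * n ≤ W := by nlinarith
  have hEu' := hEu
  rw [der_formula] at hEu'
  have hx : E (X 0) ≠ 0 := by
    intro hx
    have hy : E (X 1) ≠ 0 := fun hy => der_ne_zero hE0 hx hy
    rw [hx, mul_zero, zero_add] at hEu'
    have hp := (mul_eq_zero.1 hEu').resolve_right hy
    obtain ⟨s, hs⟩ := ne_zero_iff.1 hu0
    obtain ⟨a1, a2, a3, a4⟩ := hsupp s hs
    have hs1 := pderiv_zero hp hs
    rw [hs1] at a1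
    have : W = m * n := by push_cast at a1; nlinarith
    have ht00 : (t0 0 : ℤ) = 0 := by nlinarith
    have := pderiv_zero hp (hsupp' t0 ht0 (by rw [ht00, ht0m]; linarith))
    omega
  have hy : E (X 1) ≠ 0 := by
    intro hy
    rw [hy, mul_zero, add_zero] at hEu'
    have hp := (mul_eq_zero.1 hEu').resolve_right hx
    obtain ⟨s, hs⟩ := ne_zero_iff.1 hu0
    obtain ⟨a1, a2, a3, a4⟩ := hsupp s hs
    have hs1 := pderiv_zero hp hs
    rw [hs1] at a1
    have : W = m * n := by push_cast at a1; nlinarith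
    have ht00 : (s0 1 : ℤ) = 0 := by nlinarith
    have := pderiv_zero hp (hsupp' s0 hs0 (by rw [ht00, hs0n]; linarith))
    omega
  obtain ⟨s, hs, hs'⟩ : ∃ s, coeff s u ≠ 0 ∧ s 0 = 0 := by
    by_contra! h
    obtain ⟨g, hg⟩ := dvd_of_coeff (i := 0) (f := u) (fun s hs => by by_contra h'; exact h s h' hs)
    rw [hg] at hu0 hEu
    exact hx (lnd_fact hE hu0 hEu)
  obtain ⟨t, ht, ht'⟩ : ∃ s, coeff s u ≠ 0 ∧ s 1 = 0 := by
    by_contra! h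
    obtain ⟨g, hg⟩ := dvd_of_coeff (i := 1) (f := u) (fun s hs => by by_contra h'; exact h s h' hs)
    rw [hg] at hu0 hEu
    exact hy (lnd_fact hE hu0 hEu)
  obtain ⟨a1, a2, a3, a4⟩ := hsupp s hs
  obtain ⟨b1, b2, b3, b4⟩ := hsupp t ht
  rw [hs'] at a1
  rw [ht'] at b1
  push_cast at a1 b1
  have hWe : W = m * n := by nlinarith
  have hs1 : s 1 = m := by
    have : (s 1 : ℤ) = m := by
      have : (n : ℤ) * s 1 = n * m := by linarith
      exact mul_left_cancel₀ hn'.ne' this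
    exact_mod_cast this
  have ht1 : t 0 = n := by
    have : (t 0 : ℤ) = n := by
      have : (m : ℤ) * t 0 = m * n := by linarith
      exact mul_left_cancel₀ hm'.ne' this
    exact_mod_cast this
  refine ⟨hWe ▸ hW, ?_, ?_⟩
  · have : Finsupp.single 0 n = t := fin2_ext (by simp [ht1]) (by simp [ht'])
    rw [this]; exact b2
  · by_contra! hnd
    obtain ⟨hnd1, hnd2⟩ := hnd
    have d1 : (X 1 : PR) ∣ pderiv 1 u := by
      apply dvd_of_coeff
      intro r hr
      rw [coeff_pderiv]
      by_contra hne
      obtain ⟨c1, -, -, -⟩ := hsupp _ (left_ne_zero_of_mul hne)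
      simp [hr] at c1
      apply hnd2
      have : (m : ℤ) ∣ n := ⟨n - r 0, by linarith⟩
      exact_mod_cast this
    have d0 : (X 0 : PR) ∣ pderiv 0 u := by
      apply dvd_of_coeff
      intro r hr
      rw [coeff_pderiv]
      by_contra hne
      obtain ⟨c1, -, -, -⟩ := hsupp _ (left_ne_zero_of_mul hne)
      simp [hr] at c1
      apply hnd1
      have : (n : ℤ) ∣ m := ⟨m - r 1, by linarith⟩
      exact_mod_cast this
    have e0 : ¬ (X 1 : PR) ∣ pderiv 0 u := by
      intro h
      have h' := coeff_of_dvd h (s := Finsupp.single 0 (n - 1)) (by simp)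
      rw [coeff_pderiv] at h'
      have : Finsupp.single 0 (n - 1) + Finsupp.single 0 1 = t :=
        fin2_ext (by simp [ht1]; omega) (by simp [ht'])
      rw [this] at h'
      have h3 := (mul_eq_zero.1 h').resolve_left ht
      norm_cast at h3
    have e1 : ¬ (X 0 : PR) ∣ pderiv 1 u := by
      intro h
      have h' := coeff_of_dvd h (s := Finsupp.single 1 (m - 1)) (by simp)
      rw [coeff_pderiv] at h'
      have : Finsupp.single 1 (m - 1) + Finsupp.single 1 1 = s :=
        fin2_ext (by simp [hs']) (by simp [hs1]; omega)
      rw [this] at h'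
      have h3 := (mul_eq_zero.1 h').resolve_left hs
      norm_cast at h3
    refine lnd_cross hE hx hy ?_ ?_
    · refine (X_prime.dvd_or_dvd (a := pderiv 0 u) ?_).resolve_left e0
      rw [eq_neg_of_add_eq_zero_left hEu']
      exact (dvd_neg).2 (d1.mul_right _)
    · refine (X_prime.dvd_or_dvd (a := pderiv 1 u) ?_).resolve_left e1
      rw [eq_neg_of_add_eq_zero_right hEu']
      exact (dvd_neg).2 (d0.mul_right _)

noncomputable def sgH (c : ℂ) (k : ℕ) : PR →ₐ[ℂ] PR := aeval ![X 0 + C c * X 1 ^ k, X 1]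

lemma sgH_comp (c : ℂ) (k : ℕ) : (sgH c k).comp (sgH (-c) k) = AlgHom.id ℂ PR := by
  apply algHom_ext
  intro i
  fin_cases i <;> simp [sgH, algHom_C, algebraMap_eq]

noncomputable def sg (c : ℂ) (k : ℕ) : PR ≃ₐ[ℂ] PR :=
  AlgEquiv.ofAlgHom (sgH c k) (sgH (-c) k) (sgH_comp c k)
    (by have := sgH_comp (-c) k; rwa [neg_neg] at this)

lemma sg_X0 (c : ℂ) (k : ℕ) : sg c k (X 0) = X 0 + C c * X 1 ^ k := by simp [sg, sgH]
lemma sg_X1 (c : ℂ) (k : ℕ) : sg c k (X 1) = X 1 := by simp [sg, sgH]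
lemma sg_neg (c : ℂ) (k : ℕ) (v : PR) : sg (-c) k (sg c k v) = v := by
  have := DFunLike.congr_fun (sgH_comp (-c) k) v
  rw [neg_neg] at this
  exact this

noncomputable def tauH (α β : ℝ) (k : ℕ) : MvPolynomial (Fin 3) ℝ →ₐ[ℝ] MvPolynomial (Fin 3) ℝ :=
  aeval ![X 0 + (C α + C β * X 2) * X 1 ^ k, X 1, X 2]

lemma tauH_comp (α β : ℝ) (k : ℕ) : (tauH α β k).comp (tauH (-α) (-β) k) = AlgHom.id ℝ _ := by
  apply algHom_ext
  intro i
  fin_cases i <;> simp [tauH, algHom_C, algebraMap_eq]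
  ring

noncomputable def tau (α β : ℝ) (k : ℕ) : MvPolynomial (Fin 3) ℝ ≃ₐ[ℝ] MvPolynomial (Fin 3) ℝ :=
  AlgEquiv.ofAlgHom (tauH α β k) (tauH (-α) (-β) k) (tauH_comp α β k)
    (by have := tauH_comp (-α) (-β) k; rwa [neg_neg, neg_neg] at this)

lemma tau_ev (q : ℂ) (α β : ℝ) (k : ℕ) (f : MvPolynomial (Fin 3) ℝ) :
    evq16 q (tau α β k f) = sg (α + β * q) k (evq16 q f) := by
  have : (evq16 q).comp (tauH α β k) = ((sgH (α + β * q) k).restrictScalars ℝ).comp (evq16 q) := by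
    apply algHom_ext
    intro i
    fin_cases i <;> simp [tauH, sgH, evq16, algHom_C, algebraMap_eq, MvPolynomial.algebraMap_apply]
  exact DFunLike.congr_fun this f

noncomputable def swp : PR ≃ₐ[ℂ] PR := renameEquiv ℂ (Equiv.swap 0 1)
lemma swp_X0 : swp (X 0) = X 1 := by simp [swp]
lemma swp_X1 : swp (X 1) = X 0 := by simp [swp]
lemma swp_C (c : ℂ) : swp (C c) = C c := by simp [swp]
lemma sg_C (c : ℂ) (k : ℕ) (a : ℂ) : sg c k (C a) = C a := (sg c k).commutes a
lemma swp_swp (v : PR) : swp (swp v) = v := by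
  have h : (⇑(Equiv.swap (0 : Fin 2) 1) ∘ ⇑(Equiv.swap (0 : Fin 2) 1)) = id := by
    funext i; simp
  simp [swp, rename_rename, h]

noncomputable def swp3 : MvPolynomial (Fin 3) ℝ ≃ₐ[ℝ] MvPolynomial (Fin 3) ℝ :=
  renameEquiv ℝ (Equiv.swap 0 1)

lemma swp3_ev (q : ℂ) (f : MvPolynomial (Fin 3) ℝ) : evq16 q (swp3 f) = swp (evq16 q f) := by
  have : (evq16 q).comp (swp3 : _ →ₐ[ℝ] _) = ((swp : PR →ₐ[ℂ] PR).restrictScalars ℝ).comp (evq16 q) := by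
    apply algHom_ext
    intro i
    fin_cases i
    · simp [swp3, swp, evq16]
    · simp [swp3, swp, evq16]
    · have : (Equiv.swap (0 : Fin 3) 1) 2 = 2 := by decide
      simp [swp3, swp, evq16, this]
  exact DFunLike.congr_fun this f

def PP (q : ℂ) (v : PR) : Prop := ∃ f : MvPolynomial (Fin 3) ℝ ≃ₐ[ℝ] MvPolynomial (Fin 3) ℝ,
      f (X 2) = X 2 ∧ evq16 q (f (X 0)) = v

lemma PP_X0 (q : ℂ) : PP q (X 0) := ⟨AlgEquiv.refl, by simp, by simp [evq16]⟩

lemma PP_swp {q : ℂ} {v : PR} (h : PP q v) : PP q (swp v) := by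
  obtain ⟨f, h1, h2⟩ := h
  refine ⟨f.trans swp3, ?_, ?_⟩
  · have : (Equiv.swap (0 : Fin 3) 1) 2 = 2 := by decide
    simp [h1, swp3, this]
  · simp [swp3_ev, h2]

lemma PP_sg {q : ℂ} (hq : q.im ≠ 0) (c : ℂ) (k : ℕ) {v : PR} (h : PP q v) : PP q (sg c k v) := by
  obtain ⟨f, h1, h2⟩ := h
  have hc : c = ((c.re - c.im / q.im * q.re : ℝ) : ℂ) + ((c.im / q.im : ℝ) : ℂ) * q := by
    apply Complex.ext
    · simp [Complex.mul_re]
    · simp [Complex.mul_im]; field_simp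
  refine ⟨f.trans (tau (c.re - c.im / q.im * q.re) (c.im / q.im) k), ?_, ?_⟩
  · simp [h1, tau, tauH]
  · rw [AlgEquiv.trans_apply, tau_ev, h2, ← hc]

lemma PP_lin {q : ℂ} (hq : q.im ≠ 0) (a b : ℂ) (ha : a ≠ 0) : PP q (C a * X 0 + C b) := by
  have h := PP_sg hq (b / a) 0 (PP_sg hq (-1 / a) 1 (PP_swp (PP_sg hq (a - 1) 1 (PP_swp (PP_sg hq 1 1 (PP_X0 q))))))
  convert h using 1
  simp only [sg_X0, sg_X1, swp_X0, swp_X1, map_add, map_mul, map_pow, swp_C, sg_C]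
  have e1 : (C a : PR) * C (-1 / a) = -1 := by
    rw [← C_mul, ← C_1, ← C_neg]; congr 1; field_simp
  have e2 : (C a : PR) * C (b / a) = C b := by
    rw [← C_mul]; congr 1; field_simp
  have e3 : (C (a - 1) : PR) = C a - 1 := by simp
  rw [e3, C_1]
  linear_combination -X 1 * e1 - e2

def IsVar (v : PR) : Prop := ∃ φ : PR ≃ₐ[ℂ] PR, φ (X 0) = v

lemma IsVar.map {v : PR} (h : IsVar v) (ψ : PR ≃ₐ[ℂ] PR) : IsVar (ψ v) := by
  obtain ⟨φ, rfl⟩ := h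
  exact ⟨φ.trans ψ, rfl⟩

lemma pderiv_lnd : IsLND (pderiv 1) := by
  intro f
  obtain ⟨e, he⟩ := Fil_exists 0 1 f
  have : ∀ k : ℕ, (pderiv 1)^[k] f ∈ Fil 0 1 (e - k) := by
    intro k
    induction k with
    | zero => simpa using he
    | succ k ih =>
      rw [Function.iterate_succ_apply']
      exact Fil_mono (by push_cast; linarith) (Fil_pderiv1 ih)
  refine ⟨e.toNat + 1, ?_⟩
  ext s
  by_contra hs
  have := this _ s hs
  simp [wt16] at this
  omega

lemma IsVar.der {v : PR} (h : IsVar v) : ∃ D : Derivation ℂ PR PR, IsLND D ∧ D ≠ 0 ∧ D v = 0 := by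
  obtain ⟨φ, rfl⟩ := h
  let D : Derivation ℂ PR PR := Derivation.mk'
    (φ.toLinearMap ∘ₗ (pderiv 1 : Derivation ℂ PR PR).toLinearMap ∘ₗ φ.symm.toLinearMap) (by
      intro a b
      simp)
  have hD : ∀ f, D f = φ (pderiv 1 (φ.symm f)) := fun f => rfl
  refine ⟨D, ?_, ?_, ?_⟩
  · intro f
    obtain ⟨N, hN⟩ := pderiv_lnd (φ.symm f)
    have : ∀ k : ℕ, D^[k] f = φ ((pderiv 1)^[k] (φ.symm f)) := by
      intro k
      induction k with
      | zero => simp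
      | succ k ih => rw [Function.iterate_succ_apply', ih, hD, Function.iterate_succ_apply']; simp
    exact ⟨N, by rw [this, hN, map_zero]⟩
  · intro h
    have h1 := hD (φ (X 1))
    rw [h] at h1
    simp at h1
  · rw [hD]; simp [pderiv_X]

lemma base16 {q : ℂ} (hq : q.im ≠ 0) {v : PR} (hv : IsVar v) (h1 : degreeOf 1 v = 0) : PP q v := by
  let ψ : PR →ₐ[ℂ] Polynomial ℂ := aeval ![Polynomial.X, 0]
  have hψ : ∀ g : Polynomial ℂ, ψ (Polynomial.aeval (X 0) g) = g := by
    intro g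
    have : ψ.comp (Polynomial.aeval (X 0)) = AlgHom.id ℂ (Polynomial ℂ) := by
      apply Polynomial.algHom_ext; simp [ψ]
    exact DFunLike.congr_fun this g
  set F := ψ v with hF
  have hvF : v = Polynomial.aeval (X 0) F := by
    rw [hF, v.as_sum, map_sum, map_sum]
    refine Finset.sum_congr rfl fun s hs => ?_
    have h0 : s 1 = 0 := by
      have := monomial_le_degreeOf 1 hs; omega
    simp [ψ, aeval_monomial, Finsupp.prod_fintype, h0, monomial_eq, algebraMap_eq, Polynomial.algebraMap_apply]
  have hirr : Irreducible v := by
    obtain ⟨φ, rfl⟩ := hv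
    have : Prime (φ (X 0)) := (MulEquiv.prime_iff φ).2 X_prime
    exact this.irreducible
  have hdeg : F.degree ≠ 0 := by
    intro h
    rw [Polynomial.eq_C_of_degree_eq_zero h] at hvF
    have hc : F.coeff 0 ≠ 0 := by
      intro h0
      rw [h0] at hvF
      simp at hvF
      exact hirr.ne_zero hvF
    apply hirr.not_isUnit
    rw [hvF, Polynomial.aeval_C]
    exact (IsUnit.mk0 _ hc).map _
  obtain ⟨r, hr⟩ := IsAlgClosed.exists_root F hdeg
  obtain ⟨G, hG⟩ := Polynomial.dvd_iff_isRoot.2 hr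
  have hfac : v = Polynomial.aeval (X 0) (Polynomial.X - Polynomial.C r) * Polynomial.aeval (X 0) G := by
    rw [← map_mul, ← hG]; exact hvF
  rcases hirr.isUnit_or_isUnit hfac with h | h
  · have := h.map ψ
    rw [hψ] at this
    exact absurd this (Polynomial.not_isUnit_X_sub_C r)
  · have := h.map ψ
    rw [hψ] at this
    obtain ⟨a, ha, rfl⟩ := Polynomial.isUnit_iff.1 this
    have := PP_lin hq a (-(a * r)) ha.ne_zero
    convert this using 1
    rw [hfac]
    simp [algebraMap_eq]
    ring

lemma Fil_pow {a b e : ℤ} {f : PR} (hf : f ∈ Fil a b e) (k : ℕ) : f ^ k ∈ Fil a b (k * e) := by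
  induction k with
  | zero =>
    intro s hs
    classical
    rw [pow_zero, coeff_one] at hs
    split_ifs at hs with h
    · simp [← h, wt16]
    · exact absurd rfl hs
  | succ k ih =>
    rw [pow_succ]
    exact Fil_mono (by push_cast; linarith) (Fil_mul ih hf)

lemma X0_mem (a b : ℤ) : (X 0 : PR) ∈ Fil a b a := by
  intro s hs
  classical
  rw [coeff_X] at hs
  split_ifs at hs with h
  · simp [← h, wt16]
  · exact absurd rfl hs

lemma X1_mem (a b : ℤ) : (X 1 : PR) ∈ Fil a b b := by
  intro s hs
  classical
  rw [coeff_X] at hs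
  split_ifs at hs with h
  · simp [← h, wt16]
  · exact absurd rfl hs

lemma sg_monomial (c : ℂ) (k : ℕ) (s : Fin 2 →₀ ℕ) (r : ℂ) :
    sg c k (monomial s r) = r • ((X 0 + C c * X 1 ^ k) ^ s 0 * X 1 ^ s 1) := by
  rw [monomial_eq, map_mul, sg_C, Finsupp.prod_fintype _ _ (by simp)]
  simp [sg_X0, sg_X1, smul_eq_C_mul]

lemma sg_Fil {b : ℤ} (c : ℂ) (k : ℕ) {e : ℤ} {f : PR} (hf : f ∈ Fil (k * b) b e) :
    sg c k f ∈ Fil (k * b) b e := by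
  rw [f.as_sum, map_sum]
  refine Submodule.sum_mem _ fun s hs => ?_
  rw [sg_monomial]
  apply Submodule.smul_mem
  have h0 : (X 0 + C c * X 1 ^ k : PR) ∈ Fil (k * b) b (k * b) := by
    refine Submodule.add_mem _ (X0_mem _ _) ?_
    rw [← smul_eq_C_mul]
    exact Submodule.smul_mem _ _ (Fil_pow (X1_mem _ _) k)
  have := Fil_mul (Fil_pow h0 (s 0)) (Fil_pow (X1_mem (k * b) b) (s 1))
  refine Fil_mono ?_ this
  have := hf s (mem_support_iff.1 hs)
  simp only [wt16] at this
  linarith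

lemma coeff_y (g : PR) (m : ℕ) :
    coeff (Finsupp.single 1 m) g = ((aeval ![0, Polynomial.X] : PR →ₐ[ℂ] Polynomial ℂ) g).coeff m := by
  classical
  induction g using MvPolynomial.induction_on' with
  | monomial s r =>
    rw [coeff_monomial, aeval_monomial, Finsupp.prod_fintype _ _ (by simp)]
    simp only [Fin.prod_univ_two, Matrix.cons_val_zero, Matrix.cons_val_one, Polynomial.algebraMap_apply, Algebra.algebraMap_self, RingHom.id_apply]
    rw [Polynomial.coeff_C_mul]
    by_cases h0 : s 0 = 0
    · rw [h0, pow_zero, one_mul, Polynomial.coeff_X_pow]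
      by_cases h1 : m = s 1
      · rw [if_pos (fin2_ext (by simp [h0]) (by simp [h1])), if_pos h1, mul_one]
      · rw [if_neg, if_neg h1, mul_zero]
        intro h; apply h1; rw [h]; simp
    · rw [zero_pow h0, zero_mul, Polynomial.coeff_zero, mul_zero, if_neg]
      intro h; apply h0; rw [h]; simp
  | add f g hf hg => rw [coeff_add, hf, hg, map_add, Polynomial.coeff_add]

lemma red16 {v : PR} (hv : IsVar v) (h0 : 0 < degreeOf 0 v) (h1 : 0 < degreeOf 1 v)
    (hd : degreeOf 0 v ∣ degreeOf 1 v) :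
    ∃ c k, degreeOf 0 (sg c k v) ≤ degreeOf 0 v ∧ degreeOf 1 (sg c k v) < degreeOf 1 v := by
  classical
  obtain ⟨D, hD, hD0, hDv⟩ := hv.der
  obtain ⟨hF, hc, -⟩ := key16 hD hD0 hDv rfl rfl h0 h1
  generalize hn : degreeOf 0 v = n at *
  generalize hm : degreeOf 1 v = m at *
  obtain ⟨k, rfl⟩ := hd
  let F : Polynomial ℂ := ∑ s ∈ v.support.filter (fun s => k * s 0 + s 1 = n * k), Polynomial.monomial (s 0) (coeff s v)
  have hFn : F.coeff n ≠ 0 := by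
    have : F.coeff n = coeff (Finsupp.single 0 n) v := by
      simp only [F, Polynomial.finsetSum_coeff, Polynomial.coeff_monomial]
      rw [Finset.sum_eq_single_of_mem (Finsupp.single 0 n)]
      · simp
      · simp [hc, mul_comm]
      · intro s hs hne
        rw [if_neg]
        intro h
        apply hne
        rw [Finset.mem_filter] at hs
        have h2 := hs.2
        rw [h, mul_comm] at h2
        exact fin2_ext (by simp [h]) (by simp; omega)
    rw [this]; exact hc
  have hdeg : F.degree ≠ 0 := by
    intro h
    rw [Polynomial.eq_C_of_degree_eq_zero h, Polynomial.coeff_C, if_neg (by omega)] at hFn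
    exact hFn rfl
  obtain ⟨c, hroot⟩ := IsAlgClosed.exists_root F hdeg
  have hsF : sg c k v ∈ Fil (k * n) n (n * k * n) := by
    apply sg_Fil
    have e : ((n * k : ℕ) : ℤ) = k * n := by push_cast; ring
    rw [e] at hF
    exact Fil_mono (le_of_eq (by ring)) hF
  have hy : coeff (Finsupp.single 1 (n * k)) (sg c k v) = 0 := by
    rw [coeff_y]
    have : ((aeval ![0, Polynomial.X] : PR →ₐ[ℂ] Polynomial ℂ) (sg c k v)).coeff (n * k) = F.eval c := by
      conv_lhs => rw [v.as_sum, map_sum, map_sum]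
      simp only [F, Polynomial.eval_finsetSum, Polynomial.finsetSum_coeff, Polynomial.eval_monomial]
      rw [Finset.sum_filter]
      refine Finset.sum_congr rfl fun s _ => ?_
      rw [sg_monomial]
      have : (aeval ![0, Polynomial.X] : PR →ₐ[ℂ] Polynomial ℂ) (coeff s v • ((X 0 + C c * X 1 ^ k) ^ s 0 * X 1 ^ s 1))
        = Polynomial.C (coeff s v * c ^ s 0) * Polynomial.X ^ (k * s 0 + s 1) := by
        simp [algHom_C, Polynomial.smul_eq_C_mul, Polynomial.algebraMap_apply]
        ring
      rw [this, Polynomial.coeff_C_mul, Polynomial.coeff_X_pow]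
      by_cases h : k * s 0 + s 1 = n * k
      · rw [if_pos h, if_pos h.symm, mul_one]
      · rw [if_neg h, if_neg (Ne.symm h), mul_zero]
    rw [this]; exact hroot
  have hk : 0 < k := Nat.pos_of_mul_pos_left h1
  refine ⟨c, k, ?_, ?_⟩
  · rw [degreeOf_le_iff]
    intro s hs
    have := hsF s (mem_support_iff.1 hs)
    simp only [wt16] at this
    have h' : k * n * s 0 + n * s 1 ≤ n * k * n := by exact_mod_cast this
    have h2 : (k * n) * s 0 ≤ (k * n) * n := by nlinarith
    exact Nat.le_of_mul_le_mul_left h2 (by positivity)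
  · rw [degreeOf_lt_iff h1]
    intro s hs
    have := hsF s (mem_support_iff.1 hs)
    simp only [wt16] at this
    have h' : k * n * s 0 + n * s 1 ≤ n * k * n := by exact_mod_cast this
    have h2 : n * s 1 ≤ n * (n * k) := by nlinarith
    refine lt_of_le_of_ne (Nat.le_of_mul_le_mul_left h2 h0) ?_
    intro he
    rw [he] at h'
    have h3 : k * n * s 0 = 0 := by nlinarith
    have h4 : s 0 = 0 := by
      rcases Nat.mul_eq_zero.1 h3 with h | h
      · rw [mul_comm] at h; omega
      · exact h
    have : s = Finsupp.single 1 (n * k) := fin2_ext (by simp [h4]) (by simp [he])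
    rw [this] at hs
    exact mem_support_iff.1 hs hy

lemma deg_swp0 (v : PR) : degreeOf 0 (swp v) = degreeOf 1 v := by
  have := degreeOf_rename_of_injective (p := v) (Equiv.swap (0 : Fin 2) 1).injective 1
  simpa [swp] using this

lemma deg_swp1 (v : PR) : degreeOf 1 (swp v) = degreeOf 0 v := by
  have := degreeOf_rename_of_injective (p := v) (Equiv.swap (0 : Fin 2) 1).injective 0
  simpa [swp] using this

lemma main16 {q : ℂ} (hq : q.im ≠ 0) (N : ℕ) : ∀ v : PR, IsVar v → degreeOf 0 v + degreeOf 1 v = N → PP q v := by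
  induction N using Nat.strong_induction_on with
  | _ N ih =>
    have step : ∀ v : PR, IsVar v → degreeOf 0 v + degreeOf 1 v = N → 0 < degreeOf 0 v → 0 < degreeOf 1 v →
        degreeOf 0 v ∣ degreeOf 1 v → PP q v := by
      intro v hv hN h0 h1 hd
      obtain ⟨c, k, e0, e1⟩ := red16 hv h0 h1 hd
      have := PP_sg hq (-c) k (ih _ (by omega) (sg c k v) (hv.map _) rfl)
      rwa [sg_neg] at this
    intro v hv hN
    rcases Nat.eq_zero_or_pos (degreeOf 1 v) with h1 | h1
    · exact base16 hq hv h1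
    rcases Nat.eq_zero_or_pos (degreeOf 0 v) with h0 | h0
    · have := PP_swp (base16 hq (hv.map swp) (by rw [deg_swp1, h0]))
      rwa [swp_swp] at this
    obtain ⟨D, hD, hD0, hDv⟩ := hv.der
    obtain ⟨-, -, hd | hd⟩ := key16 hD hD0 hDv rfl rfl h0 h1
    · exact step v hv hN h0 h1 hd
    · have := PP_swp (step (swp v) (hv.map swp) (by rw [deg_swp0, deg_swp1]; omega) (by rwa [deg_swp0])
        (by rwa [deg_swp1]) (by rwa [deg_swp0, deg_swp1]))
      rwa [swp_swp] at this

/-- For every variable `v` of `ℂ[x,y]` and every `q ∈ ℂ ∖ ℝ`, there is an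
`ℝ`-algebra automorphism `f` of `ℝ[x,y,z]` fixing `z` whose first component
specializes to `v` at `z = q`. -/
theorem variable_specialization (v : MvPolynomial (Fin 2) ℂ)
    (hv : ∃ φ : MvPolynomial (Fin 2) ℂ ≃ₐ[ℂ] MvPolynomial (Fin 2) ℂ, φ (X 0) = v)
    (q : ℂ) (hq : q.im ≠ 0) :
    ∃ f : MvPolynomial (Fin 3) ℝ ≃ₐ[ℝ] MvPolynomial (Fin 3) ℝ,
      f (X 2) = X 2 ∧ evq16 q (f (X 0)) = v :=
  main16 hq _ v hv rfl
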